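/- A satisfies the linearized equation −A″ + A − 3Q²·A = 0 on ℝ, and the Wronskian relation Q″(y)·A(y) − Q′(y)·A′(y) = 1 holds for every y ∈ ℝ. -/

import Mathlib

/-- The cubic NLS soliton profile. -/
noncomputable def Q (y : ℝ) : ℝ := Real.sqrt 2 / Real.cosh y

/-- The explicit odd-growth solution of the linearized equation. -/
noncomputable def A (y : ℝ) : ℝ :=
  (Real.sqrt 2 / (4 * Real.cosh y)) * (3 * y * Real.tanh y + (Real.sinh y) ^ 2 - 2)

open Real in
theorem deriv_Q : deriv Q = fun y => -(√2 * sinh y) / cosh y ^ 2 := by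
  funext y
  have hc := (cosh_pos y).ne'
  refine HasDerivAt.deriv ?_
  refine HasDerivAt.congr_deriv ((hasDerivAt_const y √2).div (hasDerivAt_cosh y) hc) ?_
  ring

open Real in
theorem deriv_deriv_Q (y : ℝ) :
    deriv (deriv Q) y = √2 * (1 / cosh y - 2 / cosh y ^ 3) := by
  have hc := (cosh_pos y).ne'
  rw [deriv_Q]
  refine HasDerivAt.deriv ?_
  refine HasDerivAt.congr_deriv ((((hasDerivAt_sinh y).const_mul √2).neg).div ((hasDerivAt_cosh y).pow 2)
    (pow_ne_zero 2 hc)) ?_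
  simp only [Pi.neg_apply]
  field_simp
  push_cast
  linear_combination (-2 * cosh y) * cosh_sq y

open Real in
theorem A_eq : A = fun y => √2 / 4 * (3 * y * (sinh y / cosh y ^ 2) + cosh y - 3 / cosh y) := by
  funext y
  have hc := (cosh_pos y).ne'
  rw [A, tanh_eq_sinh_div_cosh]
  field_simp
  linear_combination (-cosh y) * cosh_sq y

open Real in
theorem hasDerivAt_sinh_div_cosh_sq (y : ℝ) :
    HasDerivAt (fun x => sinh x / cosh x ^ 2) (2 / cosh y ^ 3 - 1 / cosh y) y := by
  have hc := (cosh_pos y).ne'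
  refine HasDerivAt.congr_deriv ((hasDerivAt_sinh y).div ((hasDerivAt_cosh y).pow 2) (pow_ne_zero 2 hc)) ?_
  field_simp
  push_cast
  linear_combination (2 * cosh y) * cosh_sq y

open Real in
theorem deriv_A : deriv A = fun y => √2 / 4 *
    (6 * (sinh y / cosh y ^ 2) + sinh y + 3 * y * (2 / cosh y ^ 3 - 1 / cosh y)) := by
  funext y
  have hc := (cosh_pos y).ne'
  rw [A_eq]
  refine HasDerivAt.deriv ?_
  refine HasDerivAt.congr_deriv (((((((hasDerivAt_id y).const_mul 3).mul (hasDerivAt_sinh_div_cosh_sq y)).add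
    (hasDerivAt_cosh y)).sub ((hasDerivAt_const y (3 : ℝ)).div (hasDerivAt_cosh y) hc)).const_mul
    (√2 / 4))) ?_
  simp only [id]
  ring

open Real in
theorem deriv_deriv_A (y : ℝ) : deriv (deriv A) y = √2 / 4 *
    (9 * (2 / cosh y ^ 3 - 1 / cosh y) + cosh y
      + 3 * y * (sinh y / cosh y ^ 2 - 6 * sinh y / cosh y ^ 4)) := by
  have hc := (cosh_pos y).ne'
  rw [deriv_A]
  refine HasDerivAt.deriv ?_
  refine HasDerivAt.congr_deriv ((((((hasDerivAt_sinh_div_cosh_sq y).const_mul 6).add (hasDerivAt_sinh y)).add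
    (((hasDerivAt_id y).const_mul 3).mul
      (((hasDerivAt_const y (2 : ℝ)).div ((hasDerivAt_cosh y).pow 3) (pow_ne_zero 3 hc)).sub
        ((hasDerivAt_const y (1 : ℝ)).div (hasDerivAt_cosh y) hc)))).const_mul (√2 / 4))) ?_
  simp only [id, Pi.pow_apply, Pi.sub_apply, Pi.div_apply]
  field_simp
  push_cast
  ring

theorem stmt7 :
    (∀ y : ℝ, -(deriv (deriv A) y) + A y - 3 * (Q y) ^ 2 * A y = 0) ∧
    (∀ y : ℝ, deriv (deriv Q) y * A y - deriv Q y * deriv A y = 1) := by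
  have h2 : Real.sqrt 2 ^ 2 = 2 := Real.sq_sqrt (by norm_num)
  refine ⟨fun y => ?_, fun y => ?_⟩
  · have hc := (Real.cosh_pos y).ne'
    rw [deriv_deriv_A, A_eq, Q, div_pow, h2]
    field_simp
    ring
  · have hc := (Real.cosh_pos y).ne'
    rw [deriv_deriv_Q, deriv_Q, deriv_A, A_eq]
    field_simp
    rw [h2]
    have hs := Real.sinh_sq y
    ring_nf
    rw [hs]
    ring
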